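/- arXiv:2211.01152 — 10 statements merged into one kernel-verified Lean document; each statement's English description precedes it below -/
import Mathlib

section
/- Let a, k, d, x be natural numbers with a ≥ 1 and k ≥ 1, and let ε be a real number with 0 ≤ ε < 1. Suppose (k+1)·d ≤ x and (x : ℝ) ≤ ((a : ℝ) + ε)·((k+1)·d) + k. Then d ≤ x / (k+1) (natural-number floor division) and ((x / (k+1) : ℕ) : ℝ) ≤ ((a : ℝ) + (k+2)·ε)·d. -/
/-- The rounding step in the reduction from an `(a+ε, k)`-approximation on the
subdivided graph to a purely multiplicative `(a+(k+2)ε)`-approximation.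
Here `x / (k+1)` is natural-number (floor) division. -/
theorem floor_div_approx (a k d x : ℕ) (ha : 1 ≤ a) (hk : 1 ≤ k)
    (ε : ℝ) (hε0 : 0 ≤ ε) (hε1 : ε < 1)
    (h1 : (k + 1) * d ≤ x)
    (h2 : (x : ℝ) ≤ ((a : ℝ) + ε) * (((k + 1) * d : ℕ) : ℝ) + (k : ℝ)) :
    d ≤ x / (k + 1) ∧
      ((x / (k + 1) : ℕ) : ℝ) ≤ ((a : ℝ) + ((k : ℝ) + 2) * ε) * (d : ℝ) := by
  refine ⟨(Nat.le_div_iff_mul_le k.succ_pos).2 (by rwa [mul_comm]), ?_⟩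
  have hq : (k + 1) * (x / (k + 1)) ≤ x := Nat.mul_div_le x (k + 1)
  generalize x / (k + 1) = q at hq ⊢
  have hqx : ((k : ℝ) + 1) * q ≤ x := by exact_mod_cast hq
  push_cast at h2
  have hk0 : (0 : ℝ) ≤ k := k.cast_nonneg
  have he : 0 ≤ ε * d := mul_nonneg hε0 d.cast_nonneg
  rcases le_or_gt q (a * d) with hle | hlt
  · have hle' : (q : ℝ) ≤ a * d := by exact_mod_cast hle
    linarith [mul_nonneg hk0 he]
  · have hlt' : (a : ℝ) * d + 1 ≤ q := by exact_mod_cast hlt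
    have hbound : ((k : ℝ) + 1) * (q - a * d) ≤ (k + 1) * (ε * d) + k := by linarith
    have hone : 1 ≤ ((k : ℝ) + 1) * (ε * d) := by
      linarith [mul_le_mul_of_nonneg_left hlt' (by positivity : (0 : ℝ) ≤ k + 1)]
    have hexcess : (q : ℝ) - a * d ≤ (k + 1) * (ε * d) := by
      refine le_of_mul_le_mul_left ?_ (by positivity : (0 : ℝ) < k + 1)
      linarith [mul_le_mul_of_nonneg_left hone hk0]
    linarith
end

section
/- Let G be a simple graph on a vertex set V and let k be a natural number. Let G^(k) be the k-subdivision of G: the simple graph obtained by replacing each edge {u,v} of G by a path of k+1 edges through k new vertices {u,v}_1, …, {u,v}_k (the new vertex set is V plus k new vertices per edge of G). Then for all u, v ∈ V: u and v are reachable in G^(k) if and only if they are reachable in G, and if they are reachable then the graph distance satisfies d_{G^(k)}(u,v) = (k+1)·d_G(u,v). -/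
/-- The relation generating the `k`-subdivision of a simple graph `G`: each edge `e`
of `G`, oriented via `o`, is replaced by a path of `k+1` edges through the `k` new
vertices `(e, 0), …, (e, k-1)`.  (For `k = 0` the subdivision is `G` itself.) -/
def subdivRel {V : Type*} (G : SimpleGraph V) (k : ℕ) (o : G.edgeSet → V × V) :
    (V ⊕ (G.edgeSet × Fin k)) → (V ⊕ (G.edgeSet × Fin k)) → Prop
  | Sum.inl u, Sum.inl v => k = 0 ∧ G.Adj u v
  | Sum.inl u, Sum.inr ei =>
      ((ei.2 : ℕ) = 0 ∧ u = (o ei.1).1) ∨ ((ei.2 : ℕ) = k - 1 ∧ u = (o ei.1).2)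
  | Sum.inr ei, Sum.inr fj => ei.1 = fj.1 ∧ (ei.2 : ℕ) + 1 = (fj.2 : ℕ)
  | Sum.inr _, Sum.inl _ => False

/-- The `k`-subdivision `G^(k)` of a simple graph `G`, with respect to an
orientation `o` of the edges of `G`. -/
def subdivision {V : Type*} (G : SimpleGraph V) (k : ℕ) (o : G.edgeSet → V × V) :
    SimpleGraph (V ⊕ (G.edgeSet × Fin k)) :=
  SimpleGraph.fromRel (subdivRel G k o)

/-- The start of an edge is joined to the `i`-th new vertex on it by a walk of length `i + 1`. -/
theorem subdivision_exists_walk_inr {V : Type*} (G : SimpleGraph V) (k : ℕ)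
    (o : G.edgeSet → V × V) (e : G.edgeSet) (i : ℕ) (hi : i < k) :
    ∃ p : (subdivision G k o).Walk (Sum.inl (o e).1) (Sum.inr (e, ⟨i, hi⟩)),
      p.length = i + 1 := by
  induction i with
  | zero =>
    have h : (subdivision G k o).Adj (Sum.inl (o e).1) (Sum.inr (e, ⟨0, hi⟩)) := by
      simp [subdivision, subdivRel]
    exact ⟨h.toWalk, rfl⟩
  | succ i ih =>
    obtain ⟨p, hp⟩ := ih (by omega)
    have h : (subdivision G k o).Adj (Sum.inr (e, ⟨i, by omega⟩))
        (Sum.inr (e, ⟨i + 1, hi⟩)) := by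
      simp [subdivision, subdivRel]
    exact ⟨p.concat h, by simp [hp]⟩

/-- The endpoints of an edge are joined by a walk of length `k + 1` in the subdivision. -/
theorem subdivision_exists_walk_edge {V : Type*} (G : SimpleGraph V) (k : ℕ)
    (o : G.edgeSet → V × V)
    (ho : ∀ e : G.edgeSet, s((o e).1, (o e).2) = (e : Sym2 V)) (e : G.edgeSet) :
    ∃ p : (subdivision G k o).Walk (Sum.inl (o e).1) (Sum.inl (o e).2),
      p.length = k + 1 := by
  rcases Nat.eq_zero_or_pos k with rfl | hk
  · have hadj : G.Adj (o e).1 (o e).2 := by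
      rw [← SimpleGraph.mem_edgeSet, ho e]
      exact e.2
    have h : (subdivision G 0 o).Adj (Sum.inl (o e).1) (Sum.inl (o e).2) := by
      simp [subdivision, subdivRel, hadj, hadj.ne]
    exact ⟨h.toWalk, rfl⟩
  · obtain ⟨p, hp⟩ := subdivision_exists_walk_inr G k o e (k - 1) (by omega)
    have h : (subdivision G k o).Adj (Sum.inr (e, ⟨k - 1, by omega⟩)) (Sum.inl (o e).2) := by
      simp [subdivision, subdivRel]
    exact ⟨p.concat h, by simp [hp]; omega⟩

/-- Every walk of `G` lifts to a walk of the subdivision that is `k + 1` times as long. -/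
theorem subdivision_exists_walk_of_walk {V : Type*} (G : SimpleGraph V) (k : ℕ)
    (o : G.edgeSet → V × V)
    (ho : ∀ e : G.edgeSet, s((o e).1, (o e).2) = (e : Sym2 V)) {u v : V} (p : G.Walk u v) :
    ∃ q : (subdivision G k o).Walk (Sum.inl u) (Sum.inl v),
      q.length = (k + 1) * p.length := by
  induction p with
  | nil => exact ⟨.nil, by simp⟩
  | @cons a b c h p ih =>
    obtain ⟨q, hq⟩ := ih
    suffices ∃ r : (subdivision G k o).Walk (Sum.inl a) (Sum.inl b), r.length = k + 1 by
      obtain ⟨r, hr⟩ := this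
      refine ⟨r.append q, ?_⟩
      rw [SimpleGraph.Walk.length_append, SimpleGraph.Walk.length_cons, hr, hq]
      ring
    obtain ⟨r, hr⟩ := subdivision_exists_walk_edge G k o ho ⟨s(a, b), h⟩
    rcases Sym2.eq_iff.mp (ho ⟨s(a, b), h⟩) with ⟨h₁, h₂⟩ | ⟨h₁, h₂⟩
    · exact ⟨r.copy (congrArg _ h₁) (congrArg _ h₂), by simpa using hr⟩
    · exact ⟨r.reverse.copy (congrArg _ h₂) (congrArg _ h₁), by simpa using hr⟩

/-- The existence of walks in `G` to `v` that are as short as a walk of length `n` from `x` to `v`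
in the subdivision predicts: from `x` itself if `x` is a vertex of `G`, and from both endpoints of
the edge on which `x` lies otherwise. -/
def SubdivWalkBound {V : Type*} (G : SimpleGraph V) (k : ℕ) (o : G.edgeSet → V × V) (v : V)
    (n : ℕ) : V ⊕ (G.edgeSet × Fin k) → Prop
  | Sum.inl u => ∃ p : G.Walk u v, (k + 1) * p.length ≤ n
  | Sum.inr ei =>
      (∃ p : G.Walk (o ei.1).1 v, (k + 1) * p.length ≤ n + (ei.2 + 1)) ∧
        ∃ p : G.Walk (o ei.1).2 v, (k + 1) * p.length ≤ n + (k - ei.2)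

theorem SubdivWalkBound.of_adj {V : Type*} {G : SimpleGraph V} {k : ℕ} {o : G.edgeSet → V × V}
    (ho : ∀ e : G.edgeSet, s((o e).1, (o e).2) = (e : Sym2 V)) {v : V} {n : ℕ}
    {x y : V ⊕ (G.edgeSet × Fin k)} (h : (subdivision G k o).Adj x y)
    (hy : SubdivWalkBound G k o v n y) : SubdivWalkBound G k o v (n + 1) x := by
  have hadj (e : G.edgeSet) : G.Adj (o e).1 (o e).2 := by
    rw [← SimpleGraph.mem_edgeSet, ho e]
    exact e.2
  rcases x with a | ⟨e, i⟩ <;> rcases y with b | ⟨f, j⟩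
  · obtain ⟨rfl, hab⟩ : k = 0 ∧ G.Adj a b := by
      have := h.2
      simp only [subdivRel, G.adj_comm b a] at this
      tauto
    obtain ⟨p, hp⟩ := hy
    exact ⟨.cons hab p, by simpa using hp⟩
  · obtain ⟨⟨p, hp⟩, q, hq⟩ := hy
    have := h.2
    simp only [subdivRel, or_false] at this
    have := j.2
    rcases ‹_ ∨ _› with ⟨hj, rfl⟩ | ⟨hj, rfl⟩
    · exact ⟨p, by simp only at hp; omega⟩
    · exact ⟨q, by simp only at hq; omega⟩
  · obtain ⟨p, hp⟩ := hy
    have := h.2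
    simp only [subdivRel, false_or] at this
    have := i.2
    rcases ‹_ ∨ _› with ⟨hi, rfl⟩ | ⟨hi, rfl⟩
    · refine ⟨⟨p, by omega⟩, .cons (hadj e).symm p, ?_⟩
      simp only [SimpleGraph.Walk.length_cons, mul_add, mul_one]
      omega
    · refine ⟨⟨.cons (hadj e) p, ?_⟩, p, by omega⟩
      simp only [SimpleGraph.Walk.length_cons, mul_add, mul_one]
      omega
  · obtain ⟨⟨p, hp⟩, q, hq⟩ := hy
    have := h.2
    simp only [subdivRel] at this
    obtain ⟨rfl, hij⟩ : e = f ∧ ((i : ℕ) + 1 = j ∨ (j : ℕ) + 1 = i) := by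
      rcases this with ⟨rfl, hij⟩ | ⟨rfl, hij⟩ <;> simp [hij]
    simp only at hp hq
    exact ⟨⟨p, by simp only; omega⟩, q, by simp only; omega⟩

theorem SubdivWalkBound.of_walk {V : Type*} {G : SimpleGraph V} {k : ℕ} {o : G.edgeSet → V × V}
    (ho : ∀ e : G.edgeSet, s((o e).1, (o e).2) = (e : Sym2 V)) {v : V}
    {x y : V ⊕ (G.edgeSet × Fin k)} (p : (subdivision G k o).Walk x y) (hy : y = Sum.inl v) :
    SubdivWalkBound G k o v p.length x := by
  induction p with
  | nil => subst hy; exact ⟨.nil, by simp⟩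
  | cons h p ih => exact .of_adj ho h (ih hy)

/-- Vertices `u, v` of `G` are reachable in the `k`-subdivision `G^(k)` iff they are
reachable in `G`, and in that case `d_{G^(k)}(u,v) = (k+1)·d_G(u,v)`. -/
theorem subdivision_reachable_dist {V : Type*} (G : SimpleGraph V) (k : ℕ)
    (o : G.edgeSet → V × V)
    (ho : ∀ e : G.edgeSet, s((o e).1, (o e).2) = (e : Sym2 V)) (u v : V) :
    ((subdivision G k o).Reachable (Sum.inl u) (Sum.inl v) ↔ G.Reachable u v) ∧
      (G.Reachable u v →
        (subdivision G k o).dist (Sum.inl u) (Sum.inl v) = (k + 1) * G.dist u v) := by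
  refine ⟨⟨?_, ?_⟩, ?_⟩
  · rintro ⟨p⟩
    obtain ⟨q, -⟩ := SubdivWalkBound.of_walk ho p rfl
    exact ⟨q⟩
  · rintro ⟨p⟩
    obtain ⟨q, -⟩ := subdivision_exists_walk_of_walk G k o ho p
    exact ⟨q⟩
  · intro huv
    obtain ⟨p, hp⟩ := huv.exists_walk_length_eq_dist
    obtain ⟨q, hq⟩ := subdivision_exists_walk_of_walk G k o ho p
    apply le_antisymm
    · rw [← hp, ← hq]
      exact SimpleGraph.dist_le q
    · obtain ⟨r, hr⟩ := q.reachable.exists_walk_length_eq_dist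
      obtain ⟨s, hs⟩ := SubdivWalkBound.of_walk ho r rfl
      rw [← hr]
      exact (Nat.mul_le_mul_left _ (SimpleGraph.dist_le s)).trans hs
end

section
/- Let G be a simple graph on a vertex set V, let k, a be natural numbers with k ≥ 1 and a ≥ 1, and let ε be a real number with 0 ≤ ε < 1. Let G^(k) be the k-subdivision of G. Suppose δ' assigns to every pair of vertices x, y of G^(k) a natural number such that for every reachable pair x, y in G^(k): d_{G^(k)}(x,y) ≤ δ'(x,y) and (δ'(x,y) : ℝ) ≤ ((a : ℝ)+ε)·d_{G^(k)}(x,y) + k. Define δ(u,v) := δ'(u,v) / (k+1) (natural-number floor division) for u, v ∈ V. Then for all u, v ∈ V that are reachable in G: d_G(u,v) ≤ δ(u,v) and (δ(u,v) : ℝ) ≤ ((a : ℝ) + (k+2)·ε)·d_G(u,v). -/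
/-- A function increasing by at most one along each edge increases by at most the length
of a walk. -/
theorem SimpleGraph.Walk.apply_le_apply_add_length {W : Type*} {H : SimpleGraph W} {f : W → ℕ}
    (hf : ∀ x y, H.Adj x y → f y ≤ f x + 1) {x y : W} (p : H.Walk x y) :
    f y ≤ f x + p.length := by
  induction p with
  | nil => simp
  | cons h p ih =>
    have := hf _ _ h
    rw [SimpleGraph.Walk.length_cons]
    omega

theorem SimpleGraph.Adj.dist_le_dist_add_one {V : Type*} {G : SimpleGraph V} {p q : V}
    (h : G.Adj p q) (u : V) : G.dist u q ≤ G.dist u p + 1 := by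
  by_cases hr : G.Reachable u p
  · obtain ⟨w, hw⟩ := hr.exists_walk_length_eq_dist
    simpa [hw] using SimpleGraph.dist_le (w.concat h)
  · have hq : ¬ G.Reachable u q := fun hq => hr (hq.trans h.symm.reachable)
    simp [SimpleGraph.dist_eq_zero_of_not_reachable hq]

section Subdivision

variable {V : Type*} {G : SimpleGraph V} {k : ℕ} {o : G.edgeSet → V × V}

theorem adj_of_orientation (ho : ∀ e : G.edgeSet, s((o e).1, (o e).2) = (e : Sym2 V))
    (e : G.edgeSet) : G.Adj (o e).1 (o e).2 := by
  rw [← SimpleGraph.mem_edgeSet, ho e]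
  exact e.2

/-- The distance in the `k`-subdivision from the original vertex `u`, expressed through
distances in `G`. -/
noncomputable def subdivisionPotential (G : SimpleGraph V) (k : ℕ) (o : G.edgeSet → V × V)
    (u : V) : V ⊕ (G.edgeSet × Fin k) → ℕ
  | Sum.inl v => (k + 1) * G.dist u v
  | Sum.inr ei => min ((k + 1) * G.dist u (o ei.1).1 + (ei.2 + 1))
      ((k + 1) * G.dist u (o ei.1).2 + (k - ei.2))

theorem subdivisionPotential_of_rel
    (ho : ∀ e : G.edgeSet, s((o e).1, (o e).2) = (e : Sym2 V)) (hk : 1 ≤ k) (u : V)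
    (x y : V ⊕ (G.edgeSet × Fin k)) (h : subdivRel G k o x y) :
    subdivisionPotential G k o u y ≤ subdivisionPotential G k o u x + 1 ∧
      subdivisionPotential G k o u x ≤ subdivisionPotential G k o u y + 1 := by
  rcases x with x | ⟨e, i⟩ <;> rcases y with y | ⟨f, j⟩
  · exact absurd h.1 (by omega)
  · have hpq := Nat.mul_le_mul_left (k + 1)
      ((adj_of_orientation ho f).dist_le_dist_add_one u)
    have hqp := Nat.mul_le_mul_left (k + 1)
      ((adj_of_orientation ho f).symm.dist_le_dist_add_one u)
    rw [Nat.mul_add] at hpq hqp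
    rcases h with ⟨hj, rfl⟩ | ⟨hj, rfl⟩ <;> simp only [subdivisionPotential] at * <;> omega
  · exact h.elim
  · obtain ⟨he, hij⟩ := h
    obtain rfl : e = f := he
    have := j.2
    simp only [subdivisionPotential] at *
    omega

theorem mul_dist_le_length_subdivision
    (ho : ∀ e : G.edgeSet, s((o e).1, (o e).2) = (e : Sym2 V)) (hk : 1 ≤ k) {u v : V}
    (p : (subdivision G k o).Walk (Sum.inl u) (Sum.inl v)) :
    (k + 1) * G.dist u v ≤ p.length := by
  have hf : ∀ x y, (subdivision G k o).Adj x y →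
      subdivisionPotential G k o u y ≤ subdivisionPotential G k o u x + 1 := by
    intro x y h
    rcases h.2 with h | h
    · exact (subdivisionPotential_of_rel ho hk u x y h).1
    · exact (subdivisionPotential_of_rel ho hk u y x h).2
  simpa [subdivisionPotential] using p.apply_le_apply_add_length hf

theorem exists_walk_to_subdivision_vertex (e : G.edgeSet) (i : ℕ) (hi : i < k) :
    ∃ p : (subdivision G k o).Walk (Sum.inl (o e).1) (Sum.inr (e, ⟨i, hi⟩)),
      p.length = i + 1 := by
  induction i with
  | zero =>
    have h : (subdivision G k o).Adj (Sum.inl (o e).1) (Sum.inr (e, ⟨0, hi⟩)) :=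
      ⟨by simp, Or.inl (Or.inl ⟨rfl, rfl⟩)⟩
    exact ⟨h.toWalk, by simp⟩
  | succ i ih =>
    obtain ⟨p, hp⟩ := ih (by omega)
    have h : (subdivision G k o).Adj (Sum.inr (e, ⟨i, by omega⟩)) (Sum.inr (e, ⟨i + 1, hi⟩)) :=
      ⟨by simp, Or.inl ⟨rfl, rfl⟩⟩
    exact ⟨p.concat h, by simp [hp]⟩

theorem exists_walk_subdivision_of_adj
    (ho : ∀ e : G.edgeSet, s((o e).1, (o e).2) = (e : Sym2 V)) (hk : 1 ≤ k) {u v : V}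
    (h : G.Adj u v) :
    ∃ p : (subdivision G k o).Walk (Sum.inl u) (Sum.inl v), p.length = k + 1 := by
  let e : G.edgeSet := ⟨s(u, v), h⟩
  obtain ⟨p, hp⟩ := exists_walk_to_subdivision_vertex (k := k) (o := o) e (k - 1) (by omega)
  have hlast : (subdivision G k o).Adj (Sum.inr (e, ⟨k - 1, by omega⟩)) (Sum.inl (o e).2) :=
    ⟨by simp, Or.inr (Or.inr ⟨rfl, rfl⟩)⟩
  have hq : (p.concat hlast).length = k + 1 := by
    rw [SimpleGraph.Walk.length_concat]
    omega
  generalize p.concat hlast = q at hq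
  rcases Sym2.eq_iff.mp (ho e) with ⟨h₁, h₂⟩ | ⟨h₁, h₂⟩
  · exact ⟨q.copy (by rw [h₁]) (by rw [h₂]), by simpa using hq⟩
  · exact ⟨q.reverse.copy (by rw [h₂]) (by rw [h₁]), by simpa using hq⟩

theorem exists_walk_subdivision
    (ho : ∀ e : G.edgeSet, s((o e).1, (o e).2) = (e : Sym2 V)) (hk : 1 ≤ k) {u v : V}
    (w : G.Walk u v) :
    ∃ p : (subdivision G k o).Walk (Sum.inl u) (Sum.inl v),
      p.length = (k + 1) * w.length := by
  induction w with
  | nil => exact ⟨.nil, by simp⟩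
  | cons h w ih =>
    obtain ⟨p, hp⟩ := ih
    obtain ⟨q, hq⟩ := exists_walk_subdivision_of_adj ho hk h
    refine ⟨q.append p, ?_⟩
    rw [SimpleGraph.Walk.length_append, SimpleGraph.Walk.length_cons, hp, hq]
    ring

theorem SimpleGraph.Reachable.subdivision_inl
    (ho : ∀ e : G.edgeSet, s((o e).1, (o e).2) = (e : Sym2 V)) (hk : 1 ≤ k) {u v : V}
    (h : G.Reachable u v) : (subdivision G k o).Reachable (Sum.inl u) (Sum.inl v) :=
  h.elim fun w => (exists_walk_subdivision ho hk w).elim fun p _ => ⟨p⟩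

theorem dist_subdivision
    (ho : ∀ e : G.edgeSet, s((o e).1, (o e).2) = (e : Sym2 V)) (hk : 1 ≤ k) {u v : V}
    (h : G.Reachable u v) :
    (subdivision G k o).dist (Sum.inl u) (Sum.inl v) = (k + 1) * G.dist u v := by
  apply le_antisymm
  · obtain ⟨w, hw⟩ := h.exists_walk_length_eq_dist
    obtain ⟨p, hp⟩ := exists_walk_subdivision ho hk w
    rw [← hw, ← hp]
    exact SimpleGraph.dist_le p
  · obtain ⟨p, hp⟩ := (h.subdivision_inl ho hk).exists_walk_length_eq_dist
    rw [← hp]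
    exact mul_dist_le_length_subdivision ho hk p

end Subdivision

/-- Flooring turns the additive error `k` into a multiplicative one. -/
theorem natCast_div_succ_le_of_le {k a d n : ℕ} {ε : ℝ} (hε : 0 ≤ ε)
    (h : (n : ℝ) ≤ (a + ε) * ((k + 1) * d) + k) :
    ((n / (k + 1) : ℕ) : ℝ) ≤ (a + (k + 2) * ε) * d := by
  have hx : 0 ≤ ε * d := by positivity
  have hkx : 0 ≤ (k : ℝ) * (ε * d) := by positivity
  rcases le_or_gt (n / (k + 1)) (a * d) with hle | hgt
  · have : ((n / (k + 1) : ℕ) : ℝ) ≤ a * d := mod_cast hle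
    linarith
  · have hmul : (n / (k + 1) : ℕ) * ((k : ℝ) + 1) ≤ n := mod_cast Nat.div_mul_le_self n (k + 1)
    have hgt : (a : ℝ) * d + 1 ≤ (n / (k + 1) : ℕ) := mod_cast hgt
    generalize ((n / (k + 1) : ℕ) : ℝ) = m at *
    have hone : 1 ≤ (k + 1) * (ε * d) := by
      nlinarith [mul_le_mul_of_nonneg_right hgt (by positivity : (0 : ℝ) ≤ k + 1)]
    have hk : (k : ℝ) ≤ k * ((k + 1) * (ε * d)) := le_mul_of_one_le_right k.cast_nonneg hone
    have hfin : m * ((k : ℝ) + 1) ≤ (a + (k + 1) * ε) * d * (k + 1) := by linarith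
    have := le_of_mul_le_mul_right hfin (by positivity)
    linarith

/-- Theorem 2.3 of the paper: an `(a+ε, k)`-approximation `δ'` of the distances of
the `k`-subdivision `G^(k)`, rounded via `δ(u,v) = ⌊δ'(u,v)/(k+1)⌋`, is a purely
multiplicative `(a+(k+2)ε)`-approximation of the distances of `G`. -/
theorem subdivision_reduction {V : Type*} (G : SimpleGraph V) (k a : ℕ)
    (hk : 1 ≤ k) (ha : 1 ≤ a) (ε : ℝ) (hε0 : 0 ≤ ε) (hε1 : ε < 1)
    (o : G.edgeSet → V × V)
    (ho : ∀ e : G.edgeSet, s((o e).1, (o e).2) = (e : Sym2 V))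
    (δ' : (V ⊕ (G.edgeSet × Fin k)) → (V ⊕ (G.edgeSet × Fin k)) → ℕ)
    (hδ' : ∀ x y, (subdivision G k o).Reachable x y →
      (subdivision G k o).dist x y ≤ δ' x y ∧
        ((δ' x y : ℕ) : ℝ) ≤
          ((a : ℝ) + ε) * ((subdivision G k o).dist x y : ℝ) + (k : ℝ)) :
    ∀ u v : V, G.Reachable u v →
      G.dist u v ≤ δ' (Sum.inl u) (Sum.inl v) / (k + 1) ∧
        ((δ' (Sum.inl u) (Sum.inl v) / (k + 1) : ℕ) : ℝ) ≤
          ((a : ℝ) + ((k : ℝ) + 2) * ε) * (G.dist u v : ℝ) := by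
  intro u v h
  obtain ⟨hlow, hup⟩ := hδ' _ _ (h.subdivision_inl ho hk)
  rw [dist_subdivision ho hk h] at hlow hup
  refine ⟨?_, natCast_div_succ_le_of_le hε0 (mod_cast hup)⟩
  rw [Nat.le_div_iff_mul_le k.succ_pos, mul_comm]
  exact hlow
end

section
/- Let (X, d) be a pseudometric space, let W be a real number with W ≥ 0, and let u, v, u', v', p, q ∈ X. Assume d(u,u') + W + d(v',v) = d(u,v), d(u,p) ≤ d(u,u') + W, and d(v,q) ≤ W + d(v',v). Then min( d(u,p) + d(p,v), d(v,q) + d(q,u) ) ≤ 2·d(u,v) + W. -/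
/-- The exact-distance core of Case 2 in the proof of Theorem 1.2: a shortest `u`–`v`
path consists of a segment from `u` to `u'`, an edge of weight `W`, and a segment
from `v'` to `v`; `p`, `q` are pivots of `u` and `v`.  The pivot estimates give a
`(2, W)`-approximation. -/
theorem pivot_two_W_approx {X : Type*} [PseudoMetricSpace X]
    (W : ℝ) (hW : 0 ≤ W) (u v u' v' p q : X)
    (hpath : dist u u' + W + dist v' v = dist u v)
    (hp : dist u p ≤ dist u u' + W) (hq : dist v q ≤ W + dist v' v) :
    min (dist u p + dist p v) (dist v q + dist q u) ≤ 2 * dist u v + W := by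
  have hpv : dist p v ≤ dist u p + dist u v := dist_triangle_left p v u
  have hqu : dist q u ≤ dist v q + dist u v := by
    simpa only [dist_comm u v] using dist_triangle_left q u v
  rw [min_le_iff]
  by_contra! h
  linarith [h.1, h.2]
end

section
/- Let G be a simple graph on a finite vertex set V, let A ⊆ V be nonempty, and let p : V → V be a pivot function for A, i.e. p(v) ∈ A and d_G(v, p(v)) ≤ d_G(v, a) for every a ∈ A. For v ∈ V define the bunch B(v) := {w ∈ V : d_G(v,w) < d_G(v, p(v))}. Then for all u, v ∈ V with u ≠ v such that u, v and all points of A are in one connected component of G, at least one of the following holds: (a) d_G(u,p(u)) + d_G(p(u),v) ≤ 2·d_G(u,v); (b) d_G(v,p(v)) + d_G(p(v),u) ≤ 2·d_G(u,v); (c) there exist adjacent vertices u', v' of G with u' ∈ B(u), v' ∈ B(v) and d_G(u,u') + 1 + d_G(v',v) ≤ 2·d_G(u,v). -/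
/-- Correctness of the static 2-approximate APSP scheme (Section 2.1.1): for a pivot
function `p` for a sampled set `A` and bunches `B(v) = {w : d(v,w) < d(v,p(v))}`,
either one of the pivot estimates is a 2-approximation, or there is an edge `{u',v'}`
joining the two bunches giving a 2-approximate estimate. -/
theorem static_two_approx {V : Type*} [Fintype V] (G : SimpleGraph V)
    (A : Set V) (hA : A.Nonempty) (p : V → V)
    (hpA : ∀ v : V, p v ∈ A)
    (hp : ∀ v : V, ∀ a ∈ A, G.dist v (p v) ≤ G.dist v a)
    (u v : V) (huv : u ≠ v)
    (hreach : G.Reachable u v) (hreachA : ∀ a ∈ A, G.Reachable u a) :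
    G.dist u (p u) + G.dist (p u) v ≤ 2 * G.dist u v ∨
    G.dist v (p v) + G.dist (p v) u ≤ 2 * G.dist u v ∨
    ∃ u' v' : V, G.Adj u' v' ∧
      G.dist u u' < G.dist u (p u) ∧ G.dist v v' < G.dist v (p v) ∧
      G.dist u u' + 1 + G.dist v' v ≤ 2 * G.dist u v := by
  have hpos := hreach.pos_dist_of_ne huv
  have tu := hreach.dist_triangle_right (p u)
  have tv := hreach.symm.dist_triangle_right (p v)
  rw [G.dist_comm (u := p u) (v := u)] at tu
  rw [G.dist_comm (u := p v) (v := v), G.dist_comm (u := v) (v := u)] at tv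
  by_cases hu : 2 * G.dist u (p u) ≤ G.dist u v
  · left
    omega
  by_cases hv : 2 * G.dist v (p v) ≤ G.dist u v
  · right; left
    omega
  right; right
  obtain ⟨w, hw⟩ := hreach.exists_walk_length_eq_dist
  obtain ⟨i, hiu, hid, hiv⟩ : ∃ i, i < G.dist u (p u) ∧ i < G.dist u v ∧
      G.dist u v - (i + 1) < G.dist v (p v) :=
    ⟨min (G.dist u (p u) - 1) (G.dist u v - 1), by omega, by omega, by omega⟩
  have h₁ : G.dist u (w.getVert i) ≤ i :=
    (SimpleGraph.dist_le (w.take i)).trans (by simp [SimpleGraph.Walk.take_length])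
  have h₂ : G.dist (w.getVert (i + 1)) v ≤ G.dist u v - (i + 1) :=
    (SimpleGraph.dist_le (w.drop (i + 1))).trans (by simp [SimpleGraph.Walk.drop_length, hw])
  refine ⟨w.getVert i, w.getVert (i + 1), w.adj_getVert_succ (hw ▸ hid), by omega, ?_, by omega⟩
  rw [G.dist_comm]
  omega
end

section
/- Let G be a simple graph on a finite vertex set V, let A ⊆ V be nonempty, and let p : V → V be a pivot function for A, i.e. p(v) ∈ A and d_G(v, p(v)) ≤ d_G(v, a) for every a ∈ A. For v ∈ V define the bunch B(v) := {w ∈ V : d_G(v,w) < d_G(v, p(v))}. Then for all u, v ∈ V with u ≠ v such that u, v and all points of A are in one connected component of G, at least one of the following holds: (a) d_G(u,p(u)) + d_G(p(u),v) ≤ 2·d_G(u,v) + 1; (b) d_G(v,p(v)) + d_G(p(v),u) ≤ 2·d_G(u,v) + 1; (c) there exists w ∈ B(u) ∩ B(v) with d_G(u,w) + d_G(w,v) ≤ 2·d_G(u,v) + 1. -/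
/-- The unweighted static core of Theorem 1.2 (Section 2.2): with pivots `p` for a
sampled set `A` and bunches `B(v) = {w : d(v,w) < d(v,p(v))}`, either one of the
pivot estimates is a `(2,1)`-approximation, or some vertex `w ∈ B(u) ∩ B(v)` gives a
`(2,1)`-approximate estimate. -/
theorem static_two_one_approx {V : Type*} [Fintype V] (G : SimpleGraph V)
    (A : Set V) (hA : A.Nonempty) (p : V → V)
    (hpA : ∀ v : V, p v ∈ A)
    (hp : ∀ v : V, ∀ a ∈ A, G.dist v (p v) ≤ G.dist v a)
    (u v : V) (huv : u ≠ v)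
    (hreach : G.Reachable u v) (hreachA : ∀ a ∈ A, G.Reachable u a) :
    G.dist u (p u) + G.dist (p u) v ≤ 2 * G.dist u v + 1 ∨
    G.dist v (p v) + G.dist (p v) u ≤ 2 * G.dist u v + 1 ∨
    ∃ w : V, G.dist u w < G.dist u (p u) ∧ G.dist v w < G.dist v (p v) ∧
      G.dist u w + G.dist w v ≤ 2 * G.dist u v + 1 := by
  have hpu := hreach.dist_triangle_right (p u)
  have hpv := hreach.symm.dist_triangle_right (p v)
  rw [G.dist_comm (u := p u) (v := u)] at hpu
  rw [G.dist_comm (u := p v) (v := v), G.dist_comm (u := v) (v := u)] at hpv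
  -- The midpoint of a shortest path lies in both bunches when both pivot estimates fail.
  obtain ⟨q, hq⟩ := hreach.exists_walk_length_eq_dist
  have huw := SimpleGraph.dist_le (q.take (G.dist u v / 2))
  have hwv := SimpleGraph.dist_le (q.drop (G.dist u v / 2))
  rw [SimpleGraph.Walk.take_length] at huw
  rw [SimpleGraph.Walk.drop_length] at hwv
  by_contra! h
  obtain ⟨hu, hv, hw⟩ := h
  have := hw (q.getVert (G.dist u v / 2)) (by omega) (by rw [G.dist_comm]; omega)
  omega
end

section
/- Let G be a simple graph on a finite vertex set V, let A ⊆ V and H ⊆ V be nonempty, let p : V → V satisfy p(v) ∈ A and d_G(v, p(v)) ≤ d_G(v, a) for every a ∈ A, and let q : V → V satisfy q(v) ∈ H and d_G(v, q(v)) ≤ d_G(v, h) for every h ∈ H. For v ∈ V define the bunch B(v) := {w ∈ V : d_G(v,w) < d_G(v, p(v))}. Then for all u, v ∈ V with u ≠ v such that u, v and all points of A ∪ H are in one connected component of G, at least one of the following holds: (a) d_G(u,p(u)) + d_G(p(u),v) ≤ 2·d_G(u,v) + 1; (b) d_G(v,p(v)) + d_G(p(v),u) ≤ 2·d_G(u,v)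 + 1; (c) d_G(u,q(u)) + d_G(q(u),v) ≤ 2·d_G(u,v) + 1; (d) d_G(v,q(v)) + d_G(q(v),u) ≤ 2·d_G(u,v) + 1; (e) there exists w ∈ (B(u) ∩ B(v)) \ H with d_G(u,w) + d_G(w,v) ≤ 2·d_G(u,v) + 1. -/
/-- Two vertices joined by a walk have a vertex halfway along a shortest walk. -/
theorem SimpleGraph.Reachable.exists_dist_midpoint {V : Type*} {G : SimpleGraph V} {u v : V}
    (h : G.Reachable u v) :
    ∃ w : V, G.dist u w ≤ G.dist u v / 2 ∧ G.dist w v ≤ G.dist u v - G.dist u v / 2 := by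
  obtain ⟨c, hc⟩ := h.exists_walk_length_eq_dist
  refine ⟨c.getVert (G.dist u v / 2), ?_, ?_⟩
  · have := G.dist_le (c.take (G.dist u v / 2))
    rw [SimpleGraph.Walk.take_length] at this
    omega
  · have := G.dist_le (c.drop (G.dist u v / 2))
    rw [SimpleGraph.Walk.drop_length] at this
    omega


/-- The static correctness of the bunch-overlap-threshold scheme of Theorem 1.2:
with pivots `p` for the sampled set `A`, heavy pivots `q` for the heavy set `H`, and
bunches `B(v) = {w : d(v,w) < d(v,p(v))}`, one of the pivot estimates, one of the
heavy-pivot estimates, or an estimate through a light vertex `w ∈ B(u) ∩ B(v) \ H`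
is a `(2,1)`-approximation. -/
theorem static_overlap_threshold_approx {V : Type*} [Fintype V] (G : SimpleGraph V)
    (A H : Set V) (hA : A.Nonempty) (hH : H.Nonempty)
    (p q : V → V)
    (hpA : ∀ v : V, p v ∈ A)
    (hp : ∀ v : V, ∀ a ∈ A, G.dist v (p v) ≤ G.dist v a)
    (hqH : ∀ v : V, q v ∈ H)
    (hq : ∀ v : V, ∀ h ∈ H, G.dist v (q v) ≤ G.dist v h)
    (u v : V) (huv : u ≠ v)
    (hreach : G.Reachable u v) (hreachAH : ∀ a ∈ A ∪ H, G.Reachable u a) :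
    G.dist u (p u) + G.dist (p u) v ≤ 2 * G.dist u v + 1 ∨
    G.dist v (p v) + G.dist (p v) u ≤ 2 * G.dist u v + 1 ∨
    G.dist u (q u) + G.dist (q u) v ≤ 2 * G.dist u v + 1 ∨
    G.dist v (q v) + G.dist (q v) u ≤ 2 * G.dist u v + 1 ∨
    ∃ w : V, w ∉ H ∧
      G.dist u w < G.dist u (p u) ∧ G.dist v w < G.dist v (p v) ∧
      G.dist u w + G.dist w v ≤ 2 * G.dist u v + 1 := by
  obtain ⟨w, huw, hwv⟩ := hreach.exists_dist_midpoint
  have tpu := hreach.dist_triangle_right (p u)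
  have tpv := hreach.symm.dist_triangle_right (p v)
  have tqu := hreach.dist_triangle_right (q u)
  rw [G.dist_comm (v := u)] at tpu tqu
  rw [G.dist_comm (u := p v) (v := v), G.dist_comm (u := v) (v := u)] at tpv
  have hvw := G.dist_comm (u := v) (v := w)
  by_cases hw : w ∈ H
  · have := hq u w hw
    omega
  · by_contra! hcon
    obtain ⟨hpu, hpv, -, -, hlight⟩ := hcon
    have := hlight w hw (by omega) (by omega)
    omega
end

section
/- Let G be a simple graph on a vertex set V, let D ⊆ V, and let H be a subgraph of G (H ≤ G) such that for every vertex v ∈ V, either there exists x ∈ D with G.Adj v x and H.Adj v x, or every edge of G incident to v is an edge of H. Then for all u, v ∈ V with u and v reachable in G, there exists a vertex x with (x = u or x ∈ D), x and v reachable in H, and d_G(u,x) + d_H(x,v) ≤ d_G(u,v) + 2. -/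
/-- Every `G`-walk from `u` to `v` is either matched by an `H`-walk that is no longer, or can be
replaced by a `G`-walk to some `x ∈ D` followed by an `H`-walk, of total length at most 2 more. -/
theorem SimpleGraph.Walk.exists_walk_or_exists_detour {V : Type*} {G H : SimpleGraph V} {D : Set V}
    (hcov : ∀ v : V, (∃ x ∈ D, G.Adj v x ∧ H.Adj v x) ∨ (∀ x : V, G.Adj v x → H.Adj v x))
    {u v : V} (p : G.Walk u v) :
    (∃ q : H.Walk u v, q.length ≤ p.length) ∨
      ∃ x ∈ D, ∃ (r : G.Walk u x) (q : H.Walk x v), r.length + q.length ≤ p.length + 2 := by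
  induction p with
  | nil => exact .inl ⟨.nil, le_rfl⟩
  | @cons u w v huw p ih =>
    obtain ⟨q, hq⟩ | ⟨x, hx, r, q, hrq⟩ := ih
    · obtain ⟨x, hx, hG, hH⟩ | hw := hcov w
      · refine .inr ⟨x, hx, .cons huw (.cons hG .nil), .cons hH.symm q, ?_⟩
        simp only [SimpleGraph.Walk.length_cons, SimpleGraph.Walk.length_nil]
        omega
      · refine .inl ⟨.cons (hw u huw.symm).symm q, ?_⟩
        simpa only [SimpleGraph.Walk.length_cons] using Nat.succ_le_succ hq
    · refine .inr ⟨x, hx, .cons huw r, q, ?_⟩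
      simp only [SimpleGraph.Walk.length_cons]
      omega


/-- The static heart of the +2-additive APSP scheme of Dor–Halperin–Zwick used in
Section 5.2: `D` is a hitting set and `H ≤ G` a sparse subgraph such that every
vertex either keeps an `H`-edge to a `D`-neighbor or keeps all of its `G`-edges in
`H`.  Distances computed as a jump from `u` to some `x ∈ D ∪ {u}` (at exact
`G`-distance) followed by a path in `H` have additive error at most 2. -/
theorem additive_two_static {V : Type*} (G : SimpleGraph V) (D : Set V)
    (H : SimpleGraph V) (hHG : H ≤ G)
    (hcov : ∀ v : V, (∃ x ∈ D, G.Adj v x ∧ H.Adj v x) ∨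
      (∀ x : V, G.Adj v x → H.Adj v x))
    (u v : V) (huv : G.Reachable u v) :
    ∃ x : V, (x = u ∨ x ∈ D) ∧ H.Reachable x v ∧
      G.dist u x + H.dist x v ≤ G.dist u v + 2 := by
  obtain ⟨p, hp⟩ := huv.exists_walk_length_eq_dist
  obtain ⟨q, hq⟩ | ⟨x, hx, r, q, hrq⟩ := p.exists_walk_or_exists_detour hcov
  · refine ⟨u, .inl rfl, q.reachable, ?_⟩
    have := SimpleGraph.dist_le q
    rw [SimpleGraph.dist_self]
    omega
  · refine ⟨x, .inr hx, q.reachable, ?_⟩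
    have := SimpleGraph.dist_le r
    have := SimpleGraph.dist_le q
    omega
end

section
/- Let G be a simple graph on a vertex set V, let k ≥ 1, and let D₁, …, D_k be a partition of V. For each i ∈ {2,…,k} let H_i be a subgraph of G such that for every v ∈ V: either there exist i' < i and x ∈ D_{i'} with H_i.Adj v x, or every edge of G incident to v is an edge of H_i. Define estimates ℓ_i(u,v) ∈ ℕ∞ recursively: for u ∈ D₁, ℓ₁(u,v) := edist_G(u,v); for u ∈ D_i with i ≥ 2, ℓ_i(u,v) := min( edist_{H_i}(u,v), min over all i' < i and x ∈ D_{i'} of ( ℓ_{i'}(x,u) + edist_{H_i}(x,v) ) ). Then for every i ∈ {1,…,k}, every u ∈ D_i and every v ∈ V: edist_G(u,v) ≤ ℓ_i(u,v) ≤ edist_G(u,v) + 2·(i−1). -/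
/-- Follow a `G`-walk from `v` until it first leaves `H`: either it never does, or it does so
at a vertex satisfying `P`. -/
theorem SimpleGraph.Walk.edist_le_or_exists_edist_add_edist_le {V : Type*} {G H : SimpleGraph V}
    {P : V → Prop} (hP : ∀ v, P v ∨ ∀ x, G.Adj v x → H.Adj v x) {v u : V} (p : G.Walk v u) :
    H.edist v u ≤ p.length ∨ ∃ w, P w ∧ H.edist v w + G.edist w u ≤ p.length := by
  induction p with
  | nil => left; simp
  | @cons v a u h p ih =>
    rcases hP v with hv | hv
    · right
      refine ⟨v, hv, ?_⟩
      rw [SimpleGraph.edist_self, zero_add]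
      exact SimpleGraph.edist_le (SimpleGraph.Walk.cons h p)
    · have h1 : H.edist v a = 1 := SimpleGraph.edist_eq_one_iff_adj.2 (hv a h)
      rw [SimpleGraph.Walk.length_cons, Nat.cast_add, Nat.cast_one, add_comm _ (1 : ℕ∞), ← h1]
      rcases ih with ih | ⟨w, hw, ih⟩
      · left
        exact SimpleGraph.edist_triangle.trans (by gcongr)
      · right
        refine ⟨w, hw, ?_⟩
        calc H.edist v w + G.edist w u
            ≤ (H.edist v a + H.edist a w) + G.edist w u := by
              gcongr; exact SimpleGraph.edist_triangle
          _ = H.edist v a + (H.edist a w + G.edist w u) := add_assoc _ _ _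
          _ ≤ _ := by gcongr

/-- Distance version of `SimpleGraph.Walk.edist_le_or_exists_edist_add_edist_le`. -/
theorem SimpleGraph.edist_le_or_exists_edist_add_edist_le {V : Type*} {G H : SimpleGraph V}
    {P : V → Prop} (hP : ∀ v, P v ∨ ∀ x, G.Adj v x → H.Adj v x) (v u : V) :
    H.edist v u ≤ G.edist v u ∨ ∃ w, P w ∧ H.edist v w + G.edist w u ≤ G.edist v u := by
  by_cases h : G.Reachable v u
  · obtain ⟨p, hp⟩ := h.exists_walk_length_eq_edist
    rw [← hp]
    exact p.edist_le_or_exists_edist_add_edist_le hP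
  · left
    rw [SimpleGraph.edist_eq_top_of_not_reachable h]
    exact le_top


/-- The static (initial-time) content of Lemma 6.2: `D 1, …, D k` partition the
vertices, each graph `H i` (for `2 ≤ i ≤ k`) is a subgraph of `G` in which every
vertex either keeps an edge to a lower-level root or keeps all of its `G`-edges, and
the estimates `ℓ` satisfy the stated recursion.  Then the estimate of a root
`u ∈ D i` never underestimates the `G`-distance and has additive error at most
`2(i-1)`. -/
theorem hierarchical_additive_static {V : Type*} (G : SimpleGraph V)
    (k : ℕ) (hk : 1 ≤ k) (D : ℕ → Set V)
    (hpart : ∀ v : V, ∃! i : ℕ, (1 ≤ i ∧ i ≤ k) ∧ v ∈ D i)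
    (H : ℕ → SimpleGraph V)
    (hHG : ∀ i : ℕ, 2 ≤ i → i ≤ k → H i ≤ G)
    (hcov : ∀ i : ℕ, 2 ≤ i → i ≤ k → ∀ v : V,
      (∃ i' : ℕ, 1 ≤ i' ∧ i' < i ∧ ∃ x ∈ D i', (H i).Adj v x) ∨
      (∀ x : V, G.Adj v x → (H i).Adj v x))
    (ℓ : ℕ → V → V → ℕ∞)
    (hℓ1 : ∀ u ∈ D 1, ∀ v : V, ℓ 1 u v = G.edist u v)
    (hℓi : ∀ i : ℕ, 2 ≤ i → i ≤ k → ∀ u ∈ D i, ∀ v : V,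
      ℓ i u v = min ((H i).edist u v)
        (⨅ i' ∈ Finset.Ico 1 i, ⨅ x ∈ D i', ℓ i' x u + (H i).edist x v)) :
    ∀ i : ℕ, 1 ≤ i → i ≤ k → ∀ u ∈ D i, ∀ v : V,
      G.edist u v ≤ ℓ i u v ∧ ℓ i u v ≤ G.edist u v + 2 * ((i : ℕ∞) - 1) := by
  intro i
  induction i using Nat.strong_induction_on with
  | _ i ih =>
  intro hi1 hik u hu v
  obtain rfl | hi2 : i = 1 ∨ 2 ≤ i := by omega
  · rw [hℓ1 u hu v]
    exact ⟨le_rfl, le_self_add⟩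
  have hle : ∀ a b, G.edist a b ≤ (H i).edist a b := fun a b =>
    SimpleGraph.edist_anti (hHG i hi2 hik)
  rw [hℓi i hi2 hik u hu v]
  constructor
  · refine le_min (hle u v) (le_iInf₂ fun j hj => le_iInf₂ fun x hx => ?_)
    obtain ⟨hj1, hji⟩ := Finset.mem_Ico.1 hj
    calc G.edist u v ≤ G.edist u x + G.edist x v := SimpleGraph.edist_triangle
      _ = G.edist x u + G.edist x v := by rw [SimpleGraph.edist_comm]
      _ ≤ _ := add_le_add (ih j hji hj1 (by omega) x hx u).1 (hle x v)
  · rcases SimpleGraph.edist_le_or_exists_edist_add_edist_le (hcov i hi2 hik) v u with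
      h | ⟨w, ⟨j, hj1, hji, x, hx, hwx⟩, h⟩
    · rw [SimpleGraph.edist_comm (u := v), SimpleGraph.edist_comm (u := v)] at h
      exact (min_le_left _ _).trans (h.trans le_self_add)
    · have hxw : (H i).edist x w = 1 := SimpleGraph.edist_eq_one_iff_adj.2 hwx.symm
      have hxu : G.edist x u ≤ 1 + G.edist w u := by
        rw [← hxw]
        exact SimpleGraph.edist_triangle.trans (add_le_add_left (hle x w) _)
      have hxv : (H i).edist x v ≤ 1 + (H i).edist v w := by
        rw [← hxw, SimpleGraph.edist_comm (u := v)]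
        exact SimpleGraph.edist_triangle
      have herr : (2 * ((j : ℕ∞) - 1) + 2) ≤ 2 * ((i : ℕ∞) - 1) := by
        have : 2 * (j - 1) + 2 ≤ 2 * (i - 1) := by omega
        exact_mod_cast this
      calc _ ≤ ℓ j x u + (H i).edist x v :=
            (min_le_right _ _).trans <|
              (iInf₂_le j (Finset.mem_Ico.2 ⟨hj1, hji⟩)).trans (iInf₂_le x hx)
        _ ≤ (1 + G.edist w u + 2 * ((j : ℕ∞) - 1)) + (1 + (H i).edist v w) := by
            refine add_le_add ((ih j hji hj1 (by omega) x hx u).2.trans ?_) hxv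
            gcongr
        _ = ((H i).edist v w + G.edist w u) + (2 * ((j : ℕ∞) - 1) + 2) := by ring
        _ ≤ G.edist u v + 2 * ((i : ℕ∞) - 1) := by
            rw [SimpleGraph.edist_comm (u := u)]
            exact add_le_add h herr
end

section
/- Let V be a type, let d, δ₁, δ₂ : V → V → ℝ, let k be a natural number with k ≥ 1, let ε be a real number with 0 < ε ≤ 1, let β > 0, and set D₀ := 2β/ε. Assume for all u, v ∈ V: d(u,v) ≥ 0; d(u,v) ≤ δ₁(u,v); if d(u,v) ≤ D₀ then δ₁(u,v) ≤ d(u,v) + 2·(k−1); d(u,v) ≤ δ₂(u,v); and δ₂(u,v) ≤ (1+ε/2)·d(u,v) + β. Then for all u, v ∈ V: d(u,v) ≤ min(δ₁(u,v), δ₂(u,v)) ≤ (1+ε)·d(u,v) + 2·(k−1). -/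
/-- The combination argument in the proof of Theorem 6.3: `δ₁` is a `+2(k-1)`-additive
approximation of `d` for pairs at distance at most `D₀ = 2β/ε`, `δ₂` is a
`(1+ε/2, β)`-approximation for all pairs, and neither underestimates; then their
pointwise minimum is a `(1+ε, 2(k-1))`-approximation. -/
theorem combine_estimates {V : Type*} (d δ₁ δ₂ : V → V → ℝ)
    (k : ℕ) (hk : 1 ≤ k) (ε : ℝ) (hε0 : 0 < ε) (hε1 : ε ≤ 1) (β : ℝ) (hβ : 0 < β)
    (h0 : ∀ u v, 0 ≤ d u v)
    (h1 : ∀ u v, d u v ≤ δ₁ u v)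
    (h2 : ∀ u v, d u v ≤ 2 * β / ε → δ₁ u v ≤ d u v + 2 * ((k : ℝ) - 1))
    (h3 : ∀ u v, d u v ≤ δ₂ u v)
    (h4 : ∀ u v, δ₂ u v ≤ (1 + ε / 2) * d u v + β) :
    ∀ u v, d u v ≤ min (δ₁ u v) (δ₂ u v) ∧
      min (δ₁ u v) (δ₂ u v) ≤ (1 + ε) * d u v + 2 * ((k : ℝ) - 1) := by
  intro u v
  refine ⟨le_min (h1 u v) (h3 u v), ?_⟩
  have hk' : (1 : ℝ) ≤ k := by exact_mod_cast hk
  rcases le_or_gt (d u v) (2 * β / ε) with h | h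
  · have hεd := mul_nonneg hε0.le (h0 u v)
    exact (min_le_left _ _).trans (by linarith [h2 u v h])
  · rw [div_lt_iff₀ hε0] at h
    exact (min_le_right _ _).trans (by linarith [h4 u v])
end
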